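/- Let N ≥ 2 and let u_1,…,u_N, v_1,…,v_N ∈ ℂ with u_j ≠ v_j for all j, indices read modulo N (cyclically). Define α_j = (u_{j+1} − v_{j+1})/(u_j − v_j), u'_j = α_j u_j, and v'_j = α_j v_j. Then for every z ∈ ℂ, X(v',z)·X(u,z) = X(u',z)·X(v,z); consequently, for every z at which X(v,z) and X(v',z) are invertible, X(u,z)·X(v,z)^{−1} = X(v',z)^{−1}·X(u',z). Moreover ∏_{j=1}^N u'_j = ∏_{j=1}^N u_j and ∏_{j=1}^N v'_j = ∏_{j=1}^N v_j. -/

import Mathlib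

/-- The `N×N` matrix `X(u,z) = diag(u_1,…,u_N) + Λ`, where `Λ` has `1` on the
superdiagonal, `z` in the bottom-left corner, and `0` elsewhere. -/
def Xmat (N : ℕ) (u : Fin N → ℂ) (z : ℂ) : Matrix (Fin N) (Fin N) ℂ :=
  Matrix.of fun i j =>
    (if i = j then u i else 0) + (if (i : ℕ) + 1 = (j : ℕ) then 1 else 0) +
    (if (i : ℕ) = N - 1 ∧ (j : ℕ) = 0 then z else 0)

/-- Cyclic (mod `N`) indexing of a vector `u : Fin N → ℂ` by a natural number. -/
def cyc {N : ℕ} (u : Fin N → ℂ) (k : ℕ) : ℂ :=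
  if h : 0 < N then u ⟨k % N, Nat.mod_lt k h⟩ else 0

lemma Xmat_eq (n : ℕ) (u : Fin (n+2) → ℂ) (z : ℂ) (i j : Fin (n+2)) :
    Xmat (n+2) u z i j = (if i = j then u i else 0) +
      (if i + 1 = j then (if (i : ℕ) = n + 1 then z else 1) else 0) := by
  have h1 : ((i + 1 : Fin (n+2)) : ℕ) = if (i : ℕ) = n + 1 then 0 else (i : ℕ) + 1 := by
    rw [Fin.val_add_one]
    simp [Fin.ext_iff]
  have hj := j.isLt
  have hi := i.isLt
  simp only [Xmat, Matrix.of_apply, Fin.ext_iff, h1, add_assoc]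
  congr 1
  split_ifs <;> first | omega | simp

lemma Xmat_mul (n : ℕ) (a b : Fin (n+2) → ℂ) (z : ℂ) (i j : Fin (n+2)) :
    (Xmat (n+2) a z * Xmat (n+2) b z) i j = a i * Xmat (n+2) b z i j +
      (if (i : ℕ) = n + 1 then z else 1) * Xmat (n+2) b z (i+1) j := by
  rw [Matrix.mul_apply]
  simp only [Xmat_eq n a z i, add_mul, Finset.sum_add_distrib, ite_mul, zero_mul,
    Finset.sum_ite_eq, Finset.mem_univ, if_true]

lemma cyc_succ (n : ℕ) (u : Fin (n+2) → ℂ) (i : Fin (n+2)) :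
    cyc u ((i : ℕ) + 1) = u (i + 1) := by
  simp only [cyc, Nat.zero_lt_succ, dif_pos]
  congr 1

/-- the exchange transformation `s^{+,−}`: with
`α_j = (u_{j+1} − v_{j+1})/(u_j − v_j)` (indices cyclic mod `N`),
`u'_j = α_j u_j`, `v'_j = α_j v_j`, one has `X(v',z)·X(u,z) = X(u',z)·X(v,z)`
for all `z`; hence `X(u,z)·X(v,z)⁻¹ = X(v',z)⁻¹·X(u',z)` whenever `X(v,z)` and
`X(v',z)` are invertible; and the entry-products are preserved. -/
theorem stmt7 (N : ℕ) (hN : 2 ≤ N) (u v : Fin N → ℂ)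
    (huv : ∀ j : Fin N, u j ≠ v j)
    (α u' v' : Fin N → ℂ)
    (hα : ∀ j : Fin N, α j = (cyc u ((j : ℕ) + 1) - cyc v ((j : ℕ) + 1)) / (u j - v j))
    (hu' : ∀ j : Fin N, u' j = α j * u j)
    (hv' : ∀ j : Fin N, v' j = α j * v j) :
    (∀ z : ℂ, Xmat N v' z * Xmat N u z = Xmat N u' z * Xmat N v z) ∧
    (∀ z : ℂ, IsUnit (Xmat N v z) → IsUnit (Xmat N v' z) →
      Xmat N u z * (Xmat N v z)⁻¹ = (Xmat N v' z)⁻¹ * Xmat N u' z) ∧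
    (∏ j, u' j) = (∏ j, u j) ∧ (∏ j, v' j) = (∏ j, v j) := by
  obtain ⟨n, rfl⟩ : ∃ n, N = n + 2 := ⟨N - 2, by omega⟩
  have hd : ∀ j, u j - v j ≠ 0 := fun j => sub_ne_zero.mpr (huv j)
  have hk : ∀ j, α j * (u j - v j) = u (j+1) - v (j+1) := fun j => by
    rw [hα, cyc_succ, cyc_succ, div_mul_cancel₀ _ (hd j)]
  have main : ∀ z : ℂ, Xmat (n+2) v' z * Xmat (n+2) u z = Xmat (n+2) u' z * Xmat (n+2) v z := by
    intro z
    ext i j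
    rw [Xmat_mul, Xmat_mul]
    simp only [Xmat_eq, hu', hv']
    have := hk i
    generalize (if (i : ℕ) = n + 1 then z else 1) = c
    generalize (if i + 1 + 1 = j then (if ((i + 1 : Fin (n+2)) : ℕ) = n + 1 then z else 1) else 0) = d
    split_ifs <;> first | ring1 | linear_combination (-c) * this
  have hprod : ∏ j, α j = 1 := by
    have h1 : ∏ j, (α j * (u j - v j)) = ∏ j, (u j - v j) := by
      simp only [hk]
      exact Equiv.prod_comp (Equiv.addRight (1 : Fin (n+2))) (fun j => u j - v j)
    rw [Finset.prod_mul_distrib] at h1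
    exact (mul_eq_right₀ (Finset.prod_ne_zero_iff.mpr fun j _ => hd j)).mp h1
  refine ⟨main, ?_, ?_, ?_⟩
  · intro z h1 h2
    rw [Matrix.isUnit_iff_isUnit_det] at h1 h2
    calc _ = (Xmat (n+2) v' z)⁻¹ * (Xmat (n+2) v' z * Xmat (n+2) u z) * (Xmat (n+2) v z)⁻¹ := by
            rw [Matrix.nonsing_inv_mul_cancel_left _ _ h2]
      _ = _ := by
            rw [main, ← mul_assoc, Matrix.mul_nonsing_inv_cancel_right _ _ h1]
  · simp only [hu', Finset.prod_mul_distrib, hprod, one_mul]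
  · simp only [hv', Finset.prod_mul_distrib, hprod, one_mul]
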